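/- Suppose l and h are periodic with period L > 0, that cos η(L) = 1 (i.e. 1 − cos η(L) = 0), and that F(L) = 0 and G(L) = 0. Then F(t + L) = F(t), G(t + L) = G(t), y(t + L) = y(t) and x'(t + L) = x'(t) for all t ∈ ℝ; consequently the profile curve (x, y) is periodic with period L. -/

import Mathlib

open Real

/-- The primitive of a continuous `L`-periodic function is `L`-periodic up to a constant. -/
lemma integral_zero_add_period {f : ℝ → ℝ} (hf : Continuous f) {L : ℝ}
    (hper : Function.Periodic f L) (t : ℝ) :
    ∫ u in (0:ℝ)..(t + L), f u = (∫ u in (0:ℝ)..t, f u) + ∫ u in (0:ℝ)..L, f u := by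
  rw [← intervalIntegral.integral_add_adjacent_intervals (hf.intervalIntegrable 0 t)
    (hf.intervalIntegrable t (t + L)), hper.intervalIntegral_add_eq t 0, zero_add]

lemma deriv_add_period {f : ℝ → ℝ} {L c : ℝ} (hf : ∀ t, f (t + L) = f t + c) (t : ℝ) :
    deriv f (t + L) = deriv f t := by
  rw [← deriv_comp_add_const, funext hf, deriv_add_const]

lemma hasDerivAt_of_eq_integral {f g : ℝ → ℝ} (hg : Continuous g)
    (hf : ∀ t, f t = ∫ u in (0:ℝ)..t, g u) (t : ℝ) : HasDerivAt f (g t) t := by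
  rw [funext hf]
  exact hg.integral_hasStrictDerivAt 0 t |>.hasDerivAt

lemma continuous_of_eq_integral {f g : ℝ → ℝ} (hg : Continuous g)
    (hf : ∀ t, f t = ∫ u in (0:ℝ)..t, g u) : Continuous f :=
  continuous_iff_continuousAt.2 fun t => (hasDerivAt_of_eq_integral hg hf t).continuousAt

/-- If `cos η(L) = 1` and `F(L) = G(L) = 0`, then `F`, `G`, `y` and `x'` are
`L`-periodic; consequently the profile curve `(x, y)` is periodic with period `L`. -/
theorem periodic_profile_of_degenerate_case
    (l h : ℝ → ℝ) (hl : ContDiff ℝ (⊤ : ℕ∞) l) (hh : ContDiff ℝ (⊤ : ℕ∞) h)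
    (η F G : ℝ → ℝ)
    (hη : ∀ u, η u = ∫ v in (0:ℝ)..u, 2 * h v)
    (hF : ∀ t, F t = ∫ u in (0:ℝ)..t, l u * sin (η u))
    (hG : ∀ t, G t = ∫ u in (0:ℝ)..t, l u * cos (η u))
    (c₁ c₂ : ℝ)
    (hpos : ∀ t, 0 < (F t - c₁) ^ 2 + (G t - c₂) ^ 2)
    (y x : ℝ → ℝ)
    (hy : ∀ t, y t = Real.sqrt ((F t - c₁) ^ 2 + (G t - c₂) ^ 2))
    (hx : ∀ t, x t = ∫ u in (0:ℝ)..t,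
      (deriv F u * (G u - c₂) - deriv G u * (F u - c₁)) / y u)
    (L : ℝ) (hL : 0 < L)
    (hlper : ∀ t, l (t + L) = l t) (hhper : ∀ t, h (t + L) = h t)
    (hcos : cos (η L) = 1) (hFL : F L = 0) (hGL : G L = 0) :
    (∀ t, F (t + L) = F t) ∧
    (∀ t, G (t + L) = G t) ∧
    (∀ t, y (t + L) = y t) ∧
    (∀ t, deriv x (t + L) = deriv x t) ∧
    (∀ t, x (t + L) = x t + (x L - x 0)) := by
  have hlc : Continuous l := hl.continuous
  have hhc : Continuous fun v => 2 * h v := continuous_const.mul hh.continuous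
  have hηc : Continuous η := continuous_of_eq_integral hhc hη
  have hηper (t : ℝ) : η (t + L) = η t + η L := by
    simp only [hη]
    exact integral_zero_add_period hhc (fun v => by simp only [hhper]) t
  have hsin : sin (η L) = 0 := by
    have := sin_sq_add_cos_sq (η L)
    rw [hcos] at this
    nlinarith
  have hFc : Continuous fun u => l u * sin (η u) := by fun_prop
  have hGc : Continuous fun u => l u * cos (η u) := by fun_prop
  have hFper (t : ℝ) : F (t + L) = F t := by
    have := integral_zero_add_period hFc (L := L)
      (fun u => by simp [hlper, hηper, sin_add, hcos, hsin]) t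
    rwa [← hF, ← hF, ← hF, hFL, add_zero] at this
  have hGper (t : ℝ) : G (t + L) = G t := by
    have := integral_zero_add_period hGc (L := L)
      (fun u => by simp [hlper, hηper, cos_add, hcos, hsin]) t
    rwa [← hG, ← hG, ← hG, hGL, add_zero] at this
  have hyper (t : ℝ) : y (t + L) = y t := by rw [hy, hy, hFper, hGper]
  have hFcont : Continuous F := continuous_of_eq_integral hFc hF
  have hGcont : Continuous G := continuous_of_eq_integral hGc hG
  have hF' : Continuous (deriv F) := by
    rwa [funext fun t => (hasDerivAt_of_eq_integral hFc hF t).deriv]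
  have hG' : Continuous (deriv G) := by
    rwa [funext fun t => (hasDerivAt_of_eq_integral hGc hG t).deriv]
  have hycont : Continuous y := by
    rw [funext hy]
    fun_prop
  have hypos (t : ℝ) : y t ≠ 0 := by
    rw [hy]
    exact (Real.sqrt_pos.2 (hpos t)).ne'
  have hF'per := deriv_add_period (f := F) (L := L) (c := 0) (by simpa using hFper)
  have hG'per := deriv_add_period (f := G) (L := L) (c := 0) (by simpa using hGper)
  have hxc : Continuous fun u =>
      (deriv F u * (G u - c₂) - deriv G u * (F u - c₁)) / y u :=
    Continuous.div (by fun_prop) hycont hypos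
  have hxper (t : ℝ) : x (t + L) = x t + (x L - x 0) := by
    have := integral_zero_add_period hxc (L := L)
      (fun u => by simp only [hFper, hGper, hyper, hF'per, hG'per]) t
    rw [← hx, ← hx, ← hx] at this
    rw [this, hx 0, intervalIntegral.integral_same, sub_zero]
  exact ⟨hFper, hGper, hyper, deriv_add_period hxper, hxper⟩
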